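/- arXiv:1502.04286 — 2 statements merged into one kernel-verified Lean document; each statement's English description precedes it below -/
import Mathlib

section
/- Let H be a real Hilbert space, A : H → Set H a maximal monotone operator with A⁻¹(0) ≠ ∅, θ > 0, and let (x, λ, y, v) be a solution of the system (LSP) on [0, ∞) with λ nondecreasing. Then x(t) converges weakly as t → ∞ to a zero of A: there exists x∞ ∈ H with 0 ∈ A(x∞) such that for every u ∈ H, ⟪x(t), u⟫ → ⟪x∞, u⟫ as t → ∞. -/
open RealInnerProductSpace

open Filter Topology

/-- A family bounded along an ultrafilter in a Hilbert space has a weak limit along it. -/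
theorem exists_weak_limit_of_norm_le {ι H : Type*} [NormedAddCommGroup H]
    [InnerProductSpace ℝ H] [CompleteSpace H] (U : Ultrafilter ι) (x : ι → H) {R : ℝ}
    (hx : ∀ᶠ i in (U : Filter ι), ‖x i‖ ≤ R) :
    ∃ p : H, ∀ u : H, Tendsto (fun i => ⟪x i, u⟫) U (𝓝 ⟪p, u⟫) := by
  let f : ι → WeakDual ℝ H := fun i =>
    StrongDual.toWeakDual (InnerProductSpace.toDual ℝ H (x i))
  have hf : WeakDual.toStrongDual ⁻¹' Metric.closedBall (0 : StrongDual ℝ H) R ∈ U.map f := by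
    refine Ultrafilter.mem_map.2 (Ultrafilter.mem_coe.1 ?_)
    filter_upwards [hx] with i hi
    change InnerProductSpace.toDual ℝ H (x i) ∈ Metric.closedBall (0 : StrongDual ℝ H) R
    simpa using hi
  obtain ⟨g, -, hg⟩ := isCompact_iff_ultrafilter_le_nhds'.1
    (WeakDual.isCompact_closedBall (0 : StrongDual ℝ H) R) _ hf
  have hg : Tendsto f U (𝓝 g) := hg
  refine ⟨(InnerProductSpace.toDual ℝ H).symm (WeakDual.toStrongDual g), fun u => ?_⟩
  rw [InnerProductSpace.toDual_symm_apply]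
  exact ((WeakDual.eval_continuous u).tendsto g).comp hg

/-- **Opial's lemma**: if the distance from `x` to each point of a nonempty set `S` converges and
every weak cluster point of `x` lies in `S`, then `x` converges weakly to a point of `S`. -/
theorem exists_weak_limit_mem_of_tendsto_norm_sq {ι H : Type*} [NormedAddCommGroup H]
    [InnerProductSpace ℝ H] [CompleteSpace H] {l : Filter ι} [l.NeBot] {x : ι → H} {S : Set H}
    (hS : S.Nonempty) (hx : ∀ z ∈ S, ∃ c : ℝ, Tendsto (fun i => ‖x i - z‖ ^ 2) l (𝓝 c))
    (hcluster : ∀ (U : Ultrafilter ι) (p : H), (U : Filter ι) ≤ l →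
      (∀ u : H, Tendsto (fun i => ⟪x i, u⟫) U (𝓝 ⟪p, u⟫)) → p ∈ S) :
    ∃ p ∈ S, ∀ u : H, Tendsto (fun i => ⟪x i, u⟫) l (𝓝 ⟪p, u⟫) := by
  obtain ⟨z, hz⟩ := hS
  obtain ⟨c, hc⟩ := hx z hz
  have hbdd : ∀ᶠ i in l, ‖x i‖ ≤ |c| + 2 + ‖z‖ := by
    filter_upwards [hc.eventually_lt_const (lt_add_one c)] with i hi
    have h := norm_le_norm_sub_add (x i) z
    nlinarith [le_abs_self c, sq_nonneg (‖x i - z‖ - 1), abs_nonneg c]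
  have hlim (U : Ultrafilter ι) (hU : (U : Filter ι) ≤ l) :
      ∃ p ∈ S, ∀ u : H, Tendsto (fun i => ⟪x i, u⟫) U (𝓝 ⟪p, u⟫) := by
    obtain ⟨p, hp⟩ := exists_weak_limit_of_norm_le U x (hU hbdd)
    exact ⟨p, hcluster U p hU hp, hp⟩
  have hdiff {p q : H} (hp : p ∈ S) (hq : q ∈ S) :
      ∃ d : ℝ, Tendsto (fun i => ⟪x i, q - p⟫) l (𝓝 d) := by
    obtain ⟨a, ha⟩ := hx p hp
    obtain ⟨b, hb⟩ := hx q hq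
    refine ⟨(a - b - ‖p‖ ^ 2 + ‖q‖ ^ 2) / 2,
      ((((ha.sub hb).sub_const _).add_const _).div_const _).congr fun i => ?_⟩
    rw [norm_sub_sq_real, norm_sub_sq_real, inner_sub_right]
    ring
  obtain ⟨p, hpS, hp⟩ := hlim (Ultrafilter.of l) (Ultrafilter.of_le l)
  refine ⟨p, hpS, fun u => (tendsto_iff_ultrafilter _ _ _).2 fun U hU => ?_⟩
  obtain ⟨q, hqS, hq⟩ := hlim U hU
  obtain ⟨d, hd⟩ := hdiff hpS hqS
  have hpd := tendsto_nhds_unique (hp (q - p)) (hd.mono_left (Ultrafilter.of_le l))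
  have hqd := tendsto_nhds_unique (hq (q - p)) (hd.mono_left hU)
  have hqp : q = p := by
    rw [← sub_eq_zero, ← inner_self_eq_zero (𝕜 := ℝ), inner_sub_left, hpd, hqd, sub_self]
  exact hqp ▸ hq u

/-- If the inner product of the velocity of `x` with `x - z` is at most `-c`, then
`‖x - z‖ ^ 2` decreases at rate
at least `2 * c`. -/
theorem antitoneOn_norm_sub_sq_add {H : Type*} [NormedAddCommGroup H] [InnerProductSpace ℝ H]
    {D : Set ℝ} (hD : Convex ℝ D) {x x' : ℝ → H} {z : H} {c : ℝ}
    (hderiv : ∀ t ∈ D, HasDerivWithinAt x (x' t) D t)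
    (hle : ∀ t ∈ D, ⟪x' t, x t - z⟫ ≤ -c) :
    AntitoneOn (fun t => ‖x t - z‖ ^ 2 + 2 * c * t) D := by
  have h (t : ℝ) (ht : t ∈ D) : HasDerivWithinAt (fun t => ‖x t - z‖ ^ 2 + 2 * c * t)
      (2 * ⟪x t - z, x' t⟫ + 2 * c * 1) D t :=
    ((hderiv t ht).sub_const z).norm_sq.add ((hasDerivWithinAt_id t D).const_mul (2 * c))
  refine antitoneOn_of_hasDerivWithinAt_nonpos hD (fun t ht => (h t ht).continuousWithinAt)
    (fun t ht => (h t (interior_subset ht)).mono interior_subset) fun t ht => ?_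
  have := hle t (interior_subset ht)
  rw [real_inner_comm] at this
  linarith

/-- A function antitone on `[a, ∞)` and bounded below there converges at infinity. -/
theorem AntitoneOn.exists_tendsto_atTop {f : ℝ → ℝ} {a b : ℝ} (hf : AntitoneOn f (Set.Ici a))
    (hb : ∀ t, a ≤ t → b ≤ f t) : ∃ c, Tendsto f atTop (𝓝 c) := by
  have hanti : Antitone fun t => f (max t a) := fun s t hst =>
    hf (le_max_right s a) (le_max_right t a) (max_le_max_right a hst)
  refine ⟨_, (tendsto_atTop_ciInf hanti ⟨b, ?_⟩).congr' ?_⟩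
  · rintro _ ⟨t, rfl⟩
    exact hb _ (le_max_right t a)
  · filter_upwards [eventually_ge_atTop a] with t ht
    rw [max_eq_left ht]

theorem stmt_7 {H : Type*} [NormedAddCommGroup H] [InnerProductSpace ℝ H] [CompleteSpace H]
    (A : H → Set H)
    (hA : ∀ u v a b : H, u ∈ A a → v ∈ A b → 0 ≤ ⟪u - v, a - b⟫)
    (hAmax : ∀ w u : H, (∀ b v : H, v ∈ A b → 0 ≤ ⟪u - v, w - b⟫) → u ∈ A w)
    (hS : ∃ z : H, 0 ∈ A z)
    (θ : ℝ) (hθ : 0 < θ)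
    (x : ℝ → H) (l : ℝ → ℝ) (y v : ℝ → H)
    (hderiv : ∀ t, 0 ≤ t → HasDerivWithinAt x (y t - x t) (Set.Ici 0) t)
    (hlpos : ∀ t, 0 ≤ t → 0 < l t)
    (hmem : ∀ t, 0 ≤ t → v t ∈ A (y t))
    (heq : ∀ t, 0 ≤ t → l t • v t + y t - x t = 0)
    (hls : ∀ t, 0 ≤ t → l t * ‖y t - x t‖ = θ)
    (hlmono : MonotoneOn l (Set.Ici 0)) :
    ∃ xinf : H, 0 ∈ A xinf ∧
      ∀ u : H, Filter.Tendsto (fun t => ⟪x t, u⟫) Filter.atTop (nhds ⟪xinf, u⟫) := by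
  have hlv (t : ℝ) (ht : 0 ≤ t) : l t • v t = -(y t - x t) := by
    rw [eq_neg_iff_add_eq_zero, ← heq t ht]
    abel
  have hinner (z : H) (hz : 0 ∈ A z) (t : ℝ) (ht : 0 ≤ t) :
      ⟪y t - x t, x t - z⟫ ≤ -‖y t - x t‖ ^ 2 := by
    have h := mul_nonneg (hlpos t ht).le (hA _ _ _ _ (hmem t ht) hz)
    rw [sub_zero, ← real_inner_smul_left, hlv t ht, ← sub_add_sub_cancel (y t) (x t) z,
      inner_add_right, inner_neg_left, inner_neg_left, real_inner_self_eq_norm_sq] at h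
    linarith
  have hstep_anti (s t : ℝ) (hs : 0 ≤ s) (hst : s ≤ t) : ‖y t - x t‖ ≤ ‖y s - x s‖ := by
    have ht := hs.trans hst
    refine le_of_mul_le_mul_left ?_ (hlpos t ht)
    rw [hls t ht, ← hls s hs]
    exact mul_le_mul_of_nonneg_right (hlmono hs ht hst) (norm_nonneg _)
  have hfejer (z : H) (hz : 0 ∈ A z) : AntitoneOn (fun t => ‖x t - z‖ ^ 2) (Set.Ici 0) := by
    simpa using antitoneOn_norm_sub_sq_add (c := 0) (convex_Ici 0) hderiv fun t ht =>
      (hinner z hz t ht).trans (neg_le_neg (sq_nonneg _))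
  obtain ⟨z₀, hz₀⟩ := hS
  have hrate (T : ℝ) (hT : 0 ≤ T) : 2 * ‖y T - x T‖ ^ 2 * T ≤ ‖x 0 - z₀‖ ^ 2 := by
    have h := antitoneOn_norm_sub_sq_add (z := z₀) (c := ‖y T - x T‖ ^ 2) (convex_Icc 0 T)
      (fun t ht => (hderiv t ht.1).mono Set.Icc_subset_Ici_self) (fun t ht =>
        (hinner z₀ hz₀ t ht.1).trans (neg_le_neg
          (pow_le_pow_left₀ (norm_nonneg _) (hstep_anti t T ht.1 ht.2) 2)))
      ⟨le_rfl, hT⟩ ⟨hT, le_rfl⟩ hT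
    simp only [mul_zero, add_zero] at h
    linarith [sq_nonneg ‖x T - z₀‖]
  have hstep : Tendsto (fun t => y t - x t) atTop (𝓝 0) := by
    have h : Tendsto (fun t => ‖y t - x t‖ ^ 2) atTop (𝓝 0) := by
      refine squeeze_zero' (Eventually.of_forall fun t => sq_nonneg _) ?_
        ((tendsto_const_nhds (x := ‖x 0 - z₀‖ ^ 2)).div_atTop tendsto_id)
      filter_upwards [eventually_gt_atTop 0] with t ht
      rw [id, le_div_iff₀ ht]
      linarith [hrate t ht.le, mul_nonneg (sq_nonneg ‖y t - x t‖) ht.le]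
    simpa [tendsto_zero_iff_norm_tendsto_zero, Real.sqrt_sq] using h.sqrt
  have hv : Tendsto v atTop (𝓝 0) := by
    refine squeeze_zero_norm' ?_ (by simpa using hstep.norm.div_const (l 0))
    filter_upwards [eventually_ge_atTop 0] with t ht
    rw [le_div_iff₀ (hlpos 0 le_rfl), ← norm_neg (y t - x t), ← hlv t ht, norm_smul,
      Real.norm_of_nonneg (hlpos t ht).le, mul_comm]
    exact mul_le_mul_of_nonneg_right (hlmono Set.self_mem_Ici ht ht) (norm_nonneg _)
  refine exists_weak_limit_mem_of_tendsto_norm_sq (S := {z | 0 ∈ A z}) ⟨z₀, hz₀⟩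
    (fun z hz => (hfejer z hz).exists_tendsto_atTop fun t _ => sq_nonneg ‖x t - z‖) ?_
  intro U p hU hp
  refine hAmax p 0 fun b w hw => ?_
  have hy (u : H) : Tendsto (fun t => ⟪y t - b, u⟫) U (𝓝 ⟪p - b, u⟫) := by
    have h := ((hp u).add ((hstep.mono_left hU).inner (tendsto_const_nhds (x := u)))).sub_const ⟪b, u⟫
    rw [inner_zero_left, add_zero, ← inner_sub_left] at h
    refine h.congr fun t => ?_
    rw [← inner_add_left, ← inner_sub_left, add_sub_cancel]
  have hvy : Tendsto (fun t => ⟪v t, y t - b⟫) atTop (𝓝 0) := by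
    have hbound : IsBoundedUnder (· ≤ ·) atTop fun t => ‖y t - b‖ := by
      refine ⟨‖y 0 - x 0‖ + ‖x 0 - z₀‖ + ‖z₀ - b‖, eventually_map.2 ?_⟩
      filter_upwards [eventually_ge_atTop 0] with t ht
      have hx := le_of_sq_le_sq (hfejer z₀ hz₀ Set.self_mem_Ici ht ht) (norm_nonneg _)
      calc ‖y t - b‖ = ‖(y t - x t) + (x t - z₀) + (z₀ - b)‖ := by congr 1; abel
        _ ≤ ‖y t - x t‖ + ‖x t - z₀‖ + ‖z₀ - b‖ := norm_add₃_le
        _ ≤ _ := by gcongr; exact hstep_anti 0 t le_rfl ht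
    exact squeeze_zero_norm (fun t => norm_inner_le_norm (v t) (y t - b))
      ((tendsto_zero_iff_norm_tendsto_zero.1 hv).zero_mul_isBoundedUnder_le
        (by simpa [Function.comp_def] using hbound))
  have hlim := (hvy.mono_left hU).sub (hy w)
  rw [zero_sub] at hlim
  rw [zero_sub, inner_neg_left, real_inner_comm]
  refine ge_of_tendsto hlim (hU ?_)
  filter_upwards [eventually_ge_atTop 0] with t ht
  rw [real_inner_comm w, ← inner_sub_left]
  exact hA _ _ _ _ (hmem t ht) hw
end

section
/- Let (a_k)_{k ≥ 0} be a sequence of non-negative real numbers and τ ≥ 0 a real number with τ·√(a₀) ≤ 1. If a_k ≤ a_{k−1} − τ·a_{k−1}^{3/2} for all k ≥ 1, then for every k ≥ 0, a_k ≤ a₀ / (1 + k·τ·√(a₀)/2)². -/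
/-- One step of the recursion, in terms of the square roots `b = √aₖ` and `c = √aₖ₊₁`. -/
lemma mul_one_add_half_le_of_sq_le {b c τ : ℝ} (hb : 0 ≤ b) (hτ : 0 ≤ τ)
    (h : c ^ 2 ≤ b ^ 2 - τ * b ^ 3) : c * (1 + τ * b / 2) ≤ b := by
  have hx : 0 ≤ τ * b := mul_nonneg hτ hb
  refine (abs_le_of_sq_le_sq' ?_ hb).2
  calc (c * (1 + τ * b / 2)) ^ 2 = c ^ 2 * (1 + τ * b / 2) ^ 2 := by ring
    _ ≤ (b ^ 2 - τ * b ^ 3) * (1 + τ * b / 2) ^ 2 := by gcongr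
    _ = b ^ 2 - b ^ 2 * (3 / 4 * (τ * b) ^ 2 + (τ * b) ^ 3 / 4) := by ring
    _ ≤ b ^ 2 := sub_le_self _ (by positivity)

/-- The harmonic decay of a sequence with `bₖ₊₁ ≤ bₖ / (1 + t bₖ)`. -/
lemma mul_one_add_le_of_succ_mul_le {b : ℕ → ℝ} {t : ℝ} (hb : ∀ k, 0 ≤ b k)
    (h : ∀ k, b (k + 1) * (1 + t * b k) ≤ b k) (k : ℕ) :
    b k * (1 + k * (t * b 0)) ≤ b 0 := by
  induction k with
  | zero => simp
  | succ k ih =>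
    have h0 := hb 0
    have h1 := hb (k + 1)
    have hk := h k
    rcases (hb k).eq_or_lt with hz | hpos
    · have hz' : b (k + 1) = 0 := by
        rw [← hz] at hk
        linarith
      simpa [hz'] using h0
    · refine le_of_mul_le_mul_left ?_ hpos
      push_cast
      calc b k * (b (k + 1) * (1 + (k + 1) * (t * b 0)))
          = b (k + 1) * (b k * (1 + k * (t * b 0))) + b (k + 1) * (t * b k * b 0) := by ring
        _ ≤ b (k + 1) * b 0 + b (k + 1) * (t * b k * b 0) := by gcongr
        _ = b (k + 1) * (1 + t * b k) * b 0 := by ring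
        _ ≤ b k * b 0 := by gcongr

lemma rpow_three_halves_eq_sqrt_pow {x : ℝ} (hx : 0 ≤ x) :
    x ^ ((3 : ℝ) / 2) = Real.sqrt x ^ 3 := by
  rw [Real.sqrt_eq_rpow, ← Real.rpow_natCast, ← Real.rpow_mul hx]
  norm_num

theorem stmt_15 (a : ℕ → ℝ) (τ : ℝ) (ha : ∀ k, 0 ≤ a k) (hτ : 0 ≤ τ)
    (hτa : τ * Real.sqrt (a 0) ≤ 1)
    (hrec : ∀ k : ℕ, a (k + 1) ≤ a k - τ * a k ^ ((3 : ℝ) / 2)) :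
    ∀ k : ℕ, a k ≤ a 0 / (1 + (k : ℝ) * τ * Real.sqrt (a 0) / 2) ^ 2 := by
  intro k
  have hstep : ∀ k, √(a (k + 1)) * (1 + τ / 2 * √(a k)) ≤ √(a k) := fun k => by
    have h := mul_one_add_half_le_of_sq_le (b := √(a k)) (c := √(a (k + 1)))
      (Real.sqrt_nonneg _) hτ (by
        rw [Real.sq_sqrt (ha _), Real.sq_sqrt (ha _), ← rpow_three_halves_eq_sqrt_pow (ha k)]
        exact hrec k)
    rwa [mul_div_right_comm] at h
  have hk := mul_one_add_le_of_succ_mul_le (b := fun k => √(a k))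
    (fun k => Real.sqrt_nonneg _) hstep k
  rw [le_div_iff₀ (by positivity)]
  calc a k * (1 + (k : ℝ) * τ * √(a 0) / 2) ^ 2
      = (√(a k) * (1 + k * (τ / 2 * √(a 0)))) ^ 2 := by
        rw [mul_pow, Real.sq_sqrt (ha k)]
        ring
    _ ≤ √(a 0) ^ 2 := by gcongr
    _ = a 0 := Real.sq_sqrt (ha 0)
end
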